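/- Let Φ be a smooth function from an open set U of a graded Lie group G to a graded Lie group H. Then Φ is uniformly Pansu differentiable on U if and only if Φ preserves the filtration at every point x ∈ U (i.e. 𝔡_xΦ(𝔤_j) ⊆ 𝔥₁⊕⋯⊕𝔥_j for all j and all x ∈ U). Moreover, in this case the map (x, z) ↦ PD_xΦ(z) is smooth on U × G. -/

import Mathlib

open Filter Set Topology

/-- Anisotropic dilations on `ℝⁿ` with integer weights `w`:
`(gdil w r x) i = r ^ (w i) * x i`. -/
def gdil {n : ℕ} (w : Fin n → ℕ) (r : ℝ) (x : Fin n → ℝ) : Fin n → ℝ :=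
  fun i => r ^ (w i) * x i

/-- Projection onto the layer of weight `j` (the coordinates `i` with `w i = j`),
along the other layers. -/
def gproj {n : ℕ} (w : Fin n → ℕ) (j : ℕ) (v : Fin n → ℝ) : Fin n → ℝ :=
  fun i => if w i = j then v i else 0

/-- A graded nilpotent Lie group in exponential coordinates of the first kind:
the carrier is `ℝⁿ = 𝔤` (so that `exp` and `ln` are the identity), with a smooth
polynomial group law `mul` with identity `0` and inverse `-x`, a gradation
recorded by the positive weights `w` of an adapted basis, and dilations
`gdil w r` that are group automorphisms. -/
structure GradedGroup (n : ℕ) where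
  w : Fin n → ℕ
  w_pos : ∀ i, 0 < w i
  mul : (Fin n → ℝ) → (Fin n → ℝ) → (Fin n → ℝ)
  smooth : ContDiff ℝ (⊤ : ℕ∞) fun p : (Fin n → ℝ) × (Fin n → ℝ) => mul p.1 p.2
  zero_mul : ∀ x, mul 0 x = x
  mul_zero : ∀ x, mul x 0 = x
  mul_assoc : ∀ x y z, mul (mul x y) z = mul x (mul y z)
  mul_neg : ∀ x, mul x (-x) = 0
  neg_mul : ∀ x, mul (-x) x = 0
  dil_mul : ∀ (r : ℝ) (x y : Fin n → ℝ), gdil w r (mul x y) = mul (gdil w r x) (gdil w r y)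

/-- `v` belongs to the layer `𝔤_j` of the gradation: all coordinates of weight
different from `j` vanish. -/
def inLayer {n : ℕ} (w : Fin n → ℕ) (j : ℕ) (v : Fin n → ℝ) : Prop :=
  ∀ k, w k ≠ j → v k = 0

/-- The rescaled increment `δ_{ε⁻¹}(Φ(x)⁻¹ Φ(x δ_ε z))` (in exponential
coordinates) whose limit as `ε → 0⁺` defines the Pansu derivative. -/
noncomputable def pq {n m : ℕ} (Gs : GradedGroup n) (Hs : GradedGroup m)
    (Φ : (Fin n → ℝ) → (Fin m → ℝ)) (ε : ℝ) (x z : Fin n → ℝ) : Fin m → ℝ :=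
  gdil Hs.w ε⁻¹ (Hs.mul (-(Φ x)) (Φ (Gs.mul x (gdil Gs.w ε z))))

/-- Pointwise Pansu differentiability of `Φ` on `U` with derivative `PD`. -/
noncomputable def PansuPW {n m : ℕ} (Gs : GradedGroup n) (Hs : GradedGroup m)
    (Φ : (Fin n → ℝ) → (Fin m → ℝ)) (U : Set (Fin n → ℝ))
    (PD : (Fin n → ℝ) → (Fin n → ℝ) → (Fin m → ℝ)) : Prop :=
  ∀ x ∈ U, ∀ z : Fin n → ℝ,
    Tendsto (fun ε : ℝ => pq Gs Hs Φ ε x z) (𝓝[>] (0 : ℝ)) (𝓝 (PD x z))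

/-- Local uniformity of the Pansu limits on `U × G`: every point of `U × G` has
a neighbourhood on which the convergence is uniform. -/
noncomputable def PansuLocUnif {n m : ℕ} (Gs : GradedGroup n) (Hs : GradedGroup m)
    (Φ : (Fin n → ℝ) → (Fin m → ℝ)) (U : Set (Fin n → ℝ))
    (PD : (Fin n → ℝ) → (Fin n → ℝ) → (Fin m → ℝ)) : Prop :=
  ∀ x ∈ U, ∀ z : Fin n → ℝ, ∃ V ∈ 𝓝 x, ∃ Z ∈ 𝓝 z,
    TendstoUniformlyOn
      (fun (ε : ℝ) (p : (Fin n → ℝ) × (Fin n → ℝ)) => pq Gs Hs Φ ε p.1 p.2)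
      (fun p => PD p.1 p.2) (𝓝[>] (0 : ℝ)) ((V ∩ U) ×ˢ Z)

theorem abs_le_mul_pow_of_deriv_le {h h' : ℝ → ℝ} {ρ C : ℝ} {k : ℕ}
    (hc : ContinuousOn h (Ico 0 ρ)) (hd : ∀ t ∈ Ioo 0 ρ, HasDerivAt h (h' t) t)
    (hb : ∀ t ∈ Ioo 0 ρ, |h' t| ≤ C * t ^ k) (h0 : h 0 = 0) :
    ∀ t ∈ Ico 0 ρ, |h t| ≤ C * t ^ (k + 1) := by
  intro t ht
  rcases ht.1.eq_or_lt with rfl | h0t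
  · simp [h0]
  obtain ⟨c, hc1, hc2⟩ := exists_hasDerivAt_eq_slope h h' h0t
    (hc.mono fun s hs => ⟨hs.1, hs.2.trans_lt ht.2⟩)
    (fun s hs => hd s ⟨hs.1, hs.2.trans ht.2⟩)
  have hcI : c ∈ Ioo 0 ρ := ⟨hc1.1, hc1.2.trans ht.2⟩
  have hht : h t = h' c * t := by
    rw [hc2, h0, sub_zero, sub_zero, div_mul_cancel₀ _ h0t.ne']
  have hC : 0 ≤ C := by
    have h1 := (abs_nonneg _).trans (hb c hcI)
    exact nonneg_of_mul_nonneg_left h1 (pow_pos hc1.1 k)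
  rw [hht, abs_mul, abs_of_pos h0t, pow_succ, ← mul_assoc]
  refine mul_le_mul_of_nonneg_right ((hb c hcI).trans ?_) h0t.le
  exact mul_le_mul_of_nonneg_left (pow_le_pow_left₀ hc1.1.le hc1.2.le k) hC

theorem exists_taylor_expansion_fst {E : Type*} [NormedAddCommGroup E] [NormedSpace ℝ E]
    {Ω : Set (ℝ × E)} (hΩ : IsOpen Ω) {p₀ : E} (hp : ((0 : ℝ), p₀) ∈ Ω) (k : ℕ) :
    ∀ {f : ℝ × E → ℝ}, ContDiffOn ℝ (⊤ : ℕ∞) f Ω →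
    ∃ (a : ℕ → E → ℝ) (ρ : ℝ) (C : ℝ), 0 < ρ ∧
      (∀ j, ContDiffOn ℝ (⊤ : ℕ∞) (a j) (Metric.ball p₀ ρ)) ∧
      ∀ t ∈ Ico 0 ρ, ∀ p ∈ Metric.ball p₀ ρ,
        |f (t, p) - ∑ j ∈ Finset.range k, a j p * t ^ j| ≤ C * t ^ k := by
  induction k with
  | zero =>
    intro f hf
    have hcont : ContinuousAt f (0, p₀) := hf.continuousOn.continuousAt (hΩ.mem_nhds hp)
    have hev : ∀ᶠ q in 𝓝 ((0 : ℝ), p₀), |f q| < |f (0, p₀)| + 1 :=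
      hcont.abs.eventually_lt continuousAt_const (lt_add_one _)
    obtain ⟨ρ, hρ, hball⟩ := Metric.eventually_nhds_iff_ball.1 hev
    refine ⟨fun _ _ => 0, ρ, |f (0, p₀)| + 1, hρ, fun _ => contDiffOn_const, ?_⟩
    intro t ht p hpp
    have := hball (t, p) (by
      rw [← ball_prod_same]
      refine ⟨?_, hpp⟩
      simp [abs_of_nonneg ht.1, ht.2])
    simpa using this.le
  | succ k ih =>
    intro f hf
    have hf' : ContDiffOn ℝ (⊤ : ℕ∞) (fun q => fderiv ℝ f q (1, 0)) Ω :=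
      (hf.fderiv_of_isOpen hΩ (by simp)).clm_apply contDiffOn_const
    obtain ⟨a, ρ₁, C, hρ₁, ha, hbd⟩ := ih hf'
    obtain ⟨ρ₂, hρ₂, hball⟩ := Metric.isOpen_iff.1 hΩ _ hp
    rw [← ball_prod_same] at hball
    have hmem : ∀ t ∈ Ico 0 (min ρ₁ ρ₂), ∀ p ∈ Metric.ball p₀ (min ρ₁ ρ₂), (t, p) ∈ Ω := by
      intro t ht p hpp
      refine hball ⟨?_, Metric.ball_subset_ball (min_le_right _ _) hpp⟩
      simpa [abs_of_nonneg ht.1] using ht.2.trans_le (min_le_right _ _)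
    have hρ : 0 < min ρ₁ ρ₂ := lt_min hρ₁ hρ₂
    refine ⟨fun j p => if j = 0 then f (0, p) else a (j - 1) p / j, min ρ₁ ρ₂, C, hρ, ?_, ?_⟩
    · intro j
      rcases j with _ | j
      · simp only [if_true]
        exact hf.comp (by fun_prop) fun p hpp => hmem 0 ⟨le_rfl, hρ⟩ p hpp
      · simp only [Nat.succ_ne_zero, if_false, Nat.add_sub_cancel]
        exact ((ha j).mono (Metric.ball_subset_ball (min_le_left _ _))).div_const _
    · intro t ht p hpp
      have hdf : ∀ s ∈ Ico 0 (min ρ₁ ρ₂),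
          HasDerivAt (fun s => f (s, p)) (fderiv ℝ f (s, p) (1, 0)) s := by
        intro s hs
        have h1 : HasFDerivAt f (fderiv ℝ f (s, p)) (s, p) :=
          ((hf.contDiffAt (hΩ.mem_nhds (hmem s hs p hpp))).differentiableAt (by simp)).hasFDerivAt
        exact h1.comp_hasDerivAt s ((hasDerivAt_id s).prodMk (hasDerivAt_const s p))
      have hds : ∀ s : ℝ, HasDerivAt
          (fun s => f (0, p) + ∑ j ∈ Finset.range k, a j p / (j + 1 : ℕ) * s ^ (j + 1))
          (∑ j ∈ Finset.range k, a j p * s ^ j) s := by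
        intro s
        refine HasDerivAt.const_add _ (HasDerivAt.fun_sum fun j _ => ?_)
        have := (hasDerivAt_pow (j + 1) s).const_mul (a j p / (j + 1 : ℕ))
        refine this.congr_deriv ?_
        have : ((j + 1 : ℕ) : ℝ) ≠ 0 := by positivity
        field_simp
        simp
      have key := abs_le_mul_pow_of_deriv_le (ρ := min ρ₁ ρ₂) (C := C) (k := k)
        (h := fun s => f (s, p) -
          (f (0, p) + ∑ j ∈ Finset.range k, a j p / (j + 1 : ℕ) * s ^ (j + 1)))
        (fun s hs => ((hdf s hs).sub (hds s)).continuousAt.continuousWithinAt)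
        (fun s hs => (hdf s ⟨hs.1.le, hs.2⟩).sub (hds s))
        (fun s hs => hbd s ⟨hs.1.le, hs.2.trans_le (min_le_left _ _)⟩ p
          (Metric.ball_subset_ball (min_le_left _ _) hpp))
        (by simp) t ht
      rw [Finset.sum_range_succ']
      simpa [add_comm] using key

theorem coeff_eq_zero_of_isBigO {f : ℝ → ℝ} {a : ℕ → ℝ} {k : ℕ}
    (hf : (fun t => f t - ∑ j ∈ Finset.range k, a j * t ^ j) =O[𝓝[>] 0] fun t => t ^ k)
    (hO : f =O[𝓝[>] 0] fun t => t ^ k) : ∀ j < k, a j = 0 := by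
  have hS : (fun t => ∑ j ∈ Finset.range k, a j * t ^ j) =O[𝓝[>] 0] fun t : ℝ => t ^ k := by
    simpa using hO.sub hf
  intro j
  induction j using Nat.strong_induction_on with
  | _ j ih =>
    intro hj
    have hsplit : ∀ t : ℝ, ∑ i ∈ Finset.range k, a i * t ^ i =
        t ^ j * ∑ i ∈ Finset.range (k - j), a (j + i) * t ^ i := by
      intro t
      obtain ⟨d, rfl⟩ := Nat.exists_eq_add_of_lt hj
      rw [show j + d + 1 - j = d + 1 by omega, add_assoc, Finset.sum_range_add,
        Finset.sum_eq_zero, zero_add, Finset.mul_sum]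
      · exact Finset.sum_congr rfl fun i _ => by ring
      · intro i hi
        rw [ih i (Finset.mem_range.1 hi) (by have := Finset.mem_range.1 hi; omega), zero_mul]
    have hcont : Tendsto (fun t : ℝ => ∑ i ∈ Finset.range (k - j), a (j + i) * t ^ i)
        (𝓝[>] 0) (𝓝 (a j)) := by
      have : Continuous fun t : ℝ => ∑ i ∈ Finset.range (k - j), a (j + i) * t ^ i := by fun_prop
      have h2 := this.tendsto 0
      obtain ⟨d, hd⟩ : ∃ d, k - j = d + 1 := ⟨k - j - 1, by omega⟩
      rw [hd, Finset.sum_range_succ'] at h2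
      rw [hd]
      simpa using h2.mono_left nhdsWithin_le_nhds
    have hO2 : (fun t : ℝ => ∑ i ∈ Finset.range (k - j), a (j + i) * t ^ i)
        =O[𝓝[>] 0] fun t : ℝ => t ^ (k - j) := by
      obtain ⟨C, hC⟩ := hS.bound
      refine Asymptotics.IsBigO.of_bound C ?_
      filter_upwards [hC, self_mem_nhdsWithin] with t ht ht0
      have ht0 : 0 < t := ht0
      rw [hsplit, ← Nat.add_sub_cancel' hj.le, pow_add, norm_mul, norm_mul, Nat.add_sub_cancel' hj.le,
        mul_left_comm] at ht
      exact le_of_mul_le_mul_left ht (norm_pos_iff.2 (pow_pos ht0 j).ne')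
    have h0 : Tendsto (fun t : ℝ => t ^ (k - j)) (𝓝[>] 0) (𝓝 0) := by
      have := (continuous_pow (M := ℝ) (k - j)).tendsto 0
      rw [zero_pow (by omega)] at this
      exact this.mono_left nhdsWithin_le_nhds
    exact tendsto_nhds_unique hcont (hO2.trans_tendsto h0)

theorem contDiff_gdil {n : ℕ} (w : Fin n → ℕ) :
    ContDiff ℝ (⊤ : ℕ∞) fun p : ℝ × (Fin n → ℝ) => gdil w p.1 p.2 := by
  refine contDiff_pi.2 fun i => ?_
  exact (contDiff_fst.pow _).mul ((contDiff_apply ℝ ℝ i).comp contDiff_snd)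

theorem gdil_gdil {n : ℕ} (w : Fin n → ℕ) (r s : ℝ) (x : Fin n → ℝ) :
    gdil w r (gdil w s x) = gdil w (r * s) x := by
  ext i; simp only [gdil, mul_pow, mul_assoc]

theorem gdil_neg {n : ℕ} (w : Fin n → ℕ) (r : ℝ) (x : Fin n → ℝ) :
    gdil w r (-x) = -gdil w r x := by
  ext i; simp [gdil]

namespace GradedGroup

variable {n m : ℕ}

theorem gdil_zero_left (Gs : GradedGroup n) (x : Fin n → ℝ) : gdil Gs.w 0 x = 0 := by
  ext i; simp [gdil, (Gs.w_pos i).ne']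

theorem neg_mul_cancel_left (Gs : GradedGroup n) (a b : Fin n → ℝ) :
    Gs.mul (-a) (Gs.mul a b) = b := by
  rw [← Gs.mul_assoc, Gs.neg_mul, Gs.zero_mul]

theorem mul_neg_cancel_left (Gs : GradedGroup n) (a b : Fin n → ℝ) :
    Gs.mul a (Gs.mul (-a) b) = b := by
  rw [← Gs.mul_assoc, Gs.mul_neg, Gs.zero_mul]

theorem neg_mul_rev (Gs : GradedGroup n) (a b : Fin n → ℝ) :
    -(Gs.mul a b) = Gs.mul (-b) (-a) := by
  rw [← Gs.neg_mul_cancel_left (Gs.mul a b) (Gs.mul (-b) (-a)), Gs.mul_assoc a,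
    Gs.mul_neg_cancel_left, Gs.mul_neg, Gs.mul_zero]

/-- The derivative of `t ↦ y · (t e_l)` at `t = 0`: the left-invariant vector field
equal to `e_l` at the identity. -/
noncomputable def leftField (Gs : GradedGroup n) (l : Fin n) (y : Fin n → ℝ) : Fin n → ℝ :=
  fderiv ℝ (fun p : (Fin n → ℝ) × (Fin n → ℝ) => Gs.mul p.1 p.2) (y, 0) (0, Pi.single l 1)

theorem contDiff_leftField (Gs : GradedGroup n) (l : Fin n) :
    ContDiff ℝ (⊤ : ℕ∞) (Gs.leftField l) := by
  have h := (Gs.smooth.fderiv_right (m := (⊤ : ℕ∞)) (by simp)).comp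
    (contDiff_id.prodMk contDiff_const : ContDiff ℝ (⊤ : ℕ∞) fun y : Fin n → ℝ =>
      (y, (0 : Fin n → ℝ)))
  exact h.clm_apply contDiff_const

theorem hasDerivAt_mul_curve (Gs : GradedGroup n) (y : Fin n → ℝ) {c : ℝ → Fin n → ℝ}
    {v : Fin n → ℝ} {t : ℝ} (hc : HasDerivAt c v t) (hct : c t = 0) :
    HasDerivAt (fun s => Gs.mul y (c s)) (∑ l, v l • Gs.leftField l y) t := by
  have h1 : HasFDerivAt (fun p : (Fin n → ℝ) × (Fin n → ℝ) => Gs.mul p.1 p.2)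
      (fderiv ℝ (fun p : (Fin n → ℝ) × (Fin n → ℝ) => Gs.mul p.1 p.2) (y, 0)) (y, c t) := by
    rw [hct]
    exact (Gs.smooth.differentiable (by simp) _).hasFDerivAt
  refine (h1.comp_hasDerivAt t ((hasDerivAt_const t y).prodMk hc)).congr_deriv ?_
  have hv : ((0, v) : (Fin n → ℝ) × (Fin n → ℝ)) = ∑ l, v l • (0, Pi.single l 1) := by
    refine Prod.ext ?_ ?_
    · simp [Prod.fst_sum]
    · simp only [Prod.snd_sum, Prod.smul_snd]
      exact pi_eq_sum_univ' v
  rw [hv, map_sum]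
  exact Finset.sum_congr rfl fun l _ => map_smul _ _ _

theorem leftField_gdil (Gs : GradedGroup n) (l i : Fin n) (r : ℝ) (y : Fin n → ℝ) :
    r ^ Gs.w l * Gs.leftField l (gdil Gs.w r y) i = r ^ Gs.w i * Gs.leftField l y i := by
  have hs : HasDerivAt (fun s : ℝ => s • (Pi.single l 1 : Fin n → ℝ)) (Pi.single l 1) 0 := by
    simpa using (hasDerivAt_id (0 : ℝ)).smul_const (Pi.single l 1 : Fin n → ℝ)
  have h1 := hasDerivAt_pi.1 (Gs.hasDerivAt_mul_curve y hs (zero_smul _ _)) i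
  have h2 := hasDerivAt_pi.1 (Gs.hasDerivAt_mul_curve (gdil Gs.w r y)
    (hs.const_smul (r ^ Gs.w l)) (by simp)) i
  have h3 := h1.const_mul (r ^ Gs.w i)
  have heq : (fun s : ℝ => Gs.mul (gdil Gs.w r y)
      (r ^ Gs.w l • s • (Pi.single l 1 : Fin n → ℝ)) i) =
      fun s : ℝ => r ^ Gs.w i * Gs.mul y (s • (Pi.single l 1 : Fin n → ℝ)) i := by
    funext s
    have hd := congrFun (Gs.dil_mul r y (s • (Pi.single l 1 : Fin n → ℝ))) i
    rw [show gdil Gs.w r (s • (Pi.single l 1 : Fin n → ℝ)) =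
      r ^ Gs.w l • s • (Pi.single l 1 : Fin n → ℝ) from ?_] at hd
    · exact hd.symm
    · ext k
      by_cases hk : k = l
      · subst hk; simp [gdil]
      · simp [gdil, hk]
  have h4 := h2.unique (heq ▸ h3)
  simpa [Pi.single_apply, Finset.sum_apply, ite_apply] using h4

theorem tendsto_gdil_zero (Gs : GradedGroup n) (y : Fin n → ℝ) :
    Tendsto (fun r : ℝ => gdil Gs.w r y) (𝓝[>] 0) (𝓝 0) := by
  have h : Continuous fun r : ℝ => gdil Gs.w r y :=
    (contDiff_gdil Gs.w).continuous.comp (by fun_prop : Continuous fun r : ℝ => (r, y))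
  have h0 := h.tendsto 0
  rw [Gs.gdil_zero_left] at h0
  exact h0.mono_left nhdsWithin_le_nhds

theorem leftField_eq_zero (Gs : GradedGroup n) {l i : Fin n} (h : Gs.w i < Gs.w l)
    (y : Fin n → ℝ) : Gs.leftField l y i = 0 := by
  obtain ⟨d, hd⟩ := Nat.exists_eq_add_of_lt h
  have h1 : Tendsto (fun r : ℝ => r ^ (d + 1) * Gs.leftField l (gdil Gs.w r y) i) (𝓝[>] 0)
      (𝓝 (0 * Gs.leftField l 0 i)) := by
    refine Tendsto.mul ?_ ?_
    · have := (continuous_pow (M := ℝ) (d + 1)).tendsto 0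
      rw [zero_pow (by omega)] at this
      exact this.mono_left nhdsWithin_le_nhds
    · exact (((continuous_apply i).comp (Gs.contDiff_leftField l).continuous).tendsto 0).comp
        (Gs.tendsto_gdil_zero y)
  rw [MulZeroClass.zero_mul] at h1
  refine tendsto_nhds_unique (tendsto_const_nhds.congr' ?_) h1
  filter_upwards [self_mem_nhdsWithin] with r hr
  have hr : 0 < r := hr
  have := Gs.leftField_gdil l i r y
  rw [hd, add_assoc, pow_add, _root_.mul_assoc] at this
  exact (mul_left_cancel₀ (pow_pos hr _).ne' this).symm

theorem leftField_homogeneous (Gs : GradedGroup n) {l i : Fin n} (h : Gs.w l ≤ Gs.w i)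
    {r : ℝ} (hr : 0 < r) (y : Fin n → ℝ) :
    Gs.leftField l (gdil Gs.w r y) i = r ^ (Gs.w i - Gs.w l) * Gs.leftField l y i := by
  have := Gs.leftField_gdil l i r y
  rw [← pow_mul_pow_sub r h, _root_.mul_assoc] at this
  exact mul_left_cancel₀ (pow_pos hr _).ne' this

/-- Coordinates of a left-invariant field depend only on the coordinates of lower weight. -/
theorem leftField_congr (Gs : GradedGroup n) {l i : Fin n} {y y' : Fin n → ℝ}
    (hy : ∀ k, Gs.w k < Gs.w i → y k = y' k) :
    Gs.leftField l y i = Gs.leftField l y' i := by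
  rcases lt_or_ge (Gs.w i) (Gs.w l) with h | h
  · rw [Gs.leftField_eq_zero h, Gs.leftField_eq_zero h]
  set d := Gs.w i - Gs.w l with hd
  have hdi : d < Gs.w i := by have := Gs.w_pos l; omega
  have hq : ContDiff ℝ 1 fun y => Gs.leftField l y i :=
    ((contDiff_apply ℝ ℝ i).comp (Gs.contDiff_leftField l)).of_le (by norm_cast)
  obtain ⟨K, S, hS, hK⟩ := (hq.contDiffAt (x := 0)).exists_lipschitzOnWith
  have hbound : ∀ᶠ r : ℝ in 𝓝[>] 0,
      ‖Gs.leftField l y i - Gs.leftField l y' i‖ ≤ K * (r * ‖y - y'‖) := by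
    filter_upwards [self_mem_nhdsWithin, Gs.tendsto_gdil_zero y hS, Gs.tendsto_gdil_zero y' hS,
      mem_nhdsWithin_of_mem_nhds (Iio_mem_nhds one_pos)] with r hr h1 h2 hr1
    have hr : 0 < r := hr
    have hr1 : r < 1 := hr1
    have h3 := hK.norm_sub_le h1 h2
    simp only [Gs.leftField_homogeneous h hr, ← mul_sub, norm_mul] at h3
    have h4 : ‖gdil Gs.w r y - gdil Gs.w r y'‖ ≤ r ^ d * (r * ‖y - y'‖) := by
      refine (pi_norm_le_iff_of_nonneg (by positivity)).2 fun k => ?_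
      simp only [Pi.sub_apply, gdil, ← mul_sub, norm_mul]
      rcases lt_or_ge (Gs.w k) (Gs.w i) with hk | hk
      · rw [hy k hk, sub_self, norm_zero, MulZeroClass.mul_zero]; positivity
      · rw [← _root_.mul_assoc, ← pow_succ, Real.norm_of_nonneg (by positivity)]
        refine mul_le_mul ?_ (norm_le_pi_norm (y - y') k) (norm_nonneg _) (by positivity)
        exact pow_le_pow_of_le_one hr.le hr1.le (by omega)
    have h5 := h3.trans (mul_le_mul_of_nonneg_left h4 K.coe_nonneg)
    rw [Real.norm_of_nonneg (by positivity : 0 ≤ r ^ (Gs.w i - Gs.w l)), ← hd,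
      mul_left_comm] at h5
    exact le_of_mul_le_mul_left h5 (pow_pos hr d)
  have hlim : Tendsto (fun r : ℝ => K * (r * ‖y - y'‖)) (𝓝[>] 0) (𝓝 0) := by
    have : Continuous fun r : ℝ => K * (r * ‖y - y'‖) := by fun_prop
    simpa using (this.tendsto 0).mono_left nhdsWithin_le_nhds
  exact sub_eq_zero.1 (norm_le_zero_iff.1 (ge_of_tendsto hlim hbound))

theorem leftField_isBigO (Gs : GradedGroup n) {l i : Fin n} {g : ℝ → Fin n → ℝ}
    (h : Gs.w l ≤ Gs.w i)
    (hg : ∀ k, Gs.w k < Gs.w i → (fun t => g t k) =O[𝓝[>] 0] fun t => t ^ Gs.w k) :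
    (fun t => Gs.leftField l (g t) i) =O[𝓝[>] 0] fun t => t ^ (Gs.w i - Gs.w l) := by
  set y : ℝ → Fin n → ℝ := fun t k => if Gs.w k < Gs.w i then (t ^ Gs.w k)⁻¹ * g t k else 0
    with hydef
  have hy : y =O[𝓝[>] 0] fun _ => (1 : ℝ) := by
    refine Asymptotics.isBigO_pi.2 fun k => ?_
    by_cases hk : Gs.w k < Gs.w i
    · obtain ⟨C, hC⟩ := (hg k hk).bound
      refine Asymptotics.IsBigO.of_bound C ?_
      filter_upwards [hC, self_mem_nhdsWithin] with t ht ht0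
      have ht0 : 0 < t := ht0
      have hp : 0 < ‖t ^ Gs.w k‖ := norm_pos_iff.2 (pow_pos ht0 _).ne'
      simp only [hydef, hk, if_true, norm_mul, norm_inv, norm_one, mul_one]
      rwa [inv_mul_le_iff₀ hp, mul_comm]
    · simp only [hydef, hk, if_false]
      exact Asymptotics.isBigO_zero _ _
  obtain ⟨R, hR⟩ := hy.bound
  have hq : Continuous fun y => Gs.leftField l y i :=
    (continuous_apply i).comp (Gs.contDiff_leftField l).continuous
  obtain ⟨C, hC⟩ := (isCompact_closedBall (0 : Fin n → ℝ) R).exists_bound_of_continuousOn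
    hq.continuousOn
  refine Asymptotics.IsBigO.of_bound C ?_
  filter_upwards [hR, self_mem_nhdsWithin] with t ht ht0
  have ht0 : 0 < t := ht0
  have hgt : Gs.leftField l (g t) i = Gs.leftField l (gdil Gs.w t (y t)) i := by
    refine Gs.leftField_congr fun k hk => ?_
    simp only [gdil, hydef, hk, if_true]
    rw [mul_inv_cancel_left₀ (pow_pos ht0 _).ne']
  rw [hgt, Gs.leftField_homogeneous h ht0, norm_mul, mul_comm]
  exact mul_le_mul_of_nonneg_right (hC _ (by simpa using ht)) (norm_nonneg _)

end GradedGroup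

section Increment

variable {n m : ℕ} (Gs : GradedGroup n) (Hs : GradedGroup m)
  {U : Set (Fin n → ℝ)} {Φ : (Fin n → ℝ) → (Fin m → ℝ)}

/-- The increment `Φ(x)⁻¹ Φ(x v)`. -/
def increment (Φ : (Fin n → ℝ) → (Fin m → ℝ)) (p : (Fin n → ℝ) × (Fin n → ℝ)) : Fin m → ℝ :=
  Hs.mul (-(Φ p.1)) (Φ (Gs.mul p.1 p.2))

theorem increment_zero (x : Fin n → ℝ) : increment Gs Hs Φ (x, 0) = 0 := by
  simp [increment, Gs.mul_zero, Hs.neg_mul]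

theorem neg_increment_mul_increment (x a b : Fin n → ℝ) :
    Hs.mul (-(increment Gs Hs Φ (x, a))) (increment Gs Hs Φ (x, b)) =
      increment Gs Hs Φ (Gs.mul x a, Gs.mul (-a) b) := by
  simp only [increment]
  rw [Hs.neg_mul_rev, neg_neg, Hs.mul_assoc, Hs.mul_neg_cancel_left, Gs.mul_assoc,
    Gs.mul_neg_cancel_left]

theorem contDiffOn_increment (hΦ : ContDiffOn ℝ (⊤ : ℕ∞) Φ U) :
    ContDiffOn ℝ (⊤ : ℕ∞) (increment Gs Hs Φ) {p | p.1 ∈ U ∧ Gs.mul p.1 p.2 ∈ U} := by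
  refine Hs.smooth.comp_contDiffOn (ContDiffOn.prodMk ?_ ?_)
  · exact (hΦ.comp contDiffOn_fst fun p hp => hp.1).neg
  · exact hΦ.comp Gs.smooth.contDiffOn fun p hp => hp.2

theorem isOpen_increment_domain (hU : IsOpen U) :
    IsOpen {p : (Fin n → ℝ) × (Fin n → ℝ) | p.1 ∈ U ∧ Gs.mul p.1 p.2 ∈ U} :=
  (hU.preimage continuous_fst).inter (hU.preimage Gs.smooth.continuous)

/-- The left-translated differential of `Φ` at `y`. -/
noncomputable def leftDiff (Φ : (Fin n → ℝ) → (Fin m → ℝ)) (y : Fin n → ℝ) :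
    (Fin n → ℝ) →L[ℝ] (Fin m → ℝ) :=
  (fderiv ℝ (increment Gs Hs Φ) (y, 0)).comp (ContinuousLinearMap.inr ℝ _ _)

theorem hasDerivAt_increment_curve (hU : IsOpen U) (hΦ : ContDiffOn ℝ (⊤ : ℕ∞) Φ U)
    {y : Fin n → ℝ} (hy : y ∈ U) {c : ℝ → Fin n → ℝ} {v : Fin n → ℝ} {t : ℝ}
    (hc : HasDerivAt c v t) (hct : c t = 0) :
    HasDerivAt (fun s => increment Gs Hs Φ (y, c s)) (leftDiff Gs Hs Φ y v) t := by
  have h1 : HasFDerivAt (increment Gs Hs Φ) (fderiv ℝ (increment Gs Hs Φ) (y, 0)) (y, c t) := by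
    rw [hct]
    refine (((contDiffOn_increment Gs Hs hΦ).contDiffAt
      ((isOpen_increment_domain Gs hU).mem_nhds ?_)).differentiableAt (by simp)).hasFDerivAt
    exact ⟨hy, by simpa [Gs.mul_zero] using hy⟩
  exact h1.comp_hasDerivAt t ((hasDerivAt_const t y).prodMk hc)

theorem continuousOn_leftDiff (hU : IsOpen U) (hΦ : ContDiffOn ℝ (⊤ : ℕ∞) Φ U) :
    ContinuousOn (leftDiff Gs Hs Φ) U := by
  have h1 := (contDiffOn_increment Gs Hs hΦ).continuousOn_fderiv_of_isOpen
    (isOpen_increment_domain Gs hU) (by simp)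
  refine (h1.comp (by fun_prop : ContinuousOn (fun y : Fin n → ℝ => (y, (0 : Fin n → ℝ))) U)
    fun y hy => ⟨hy, by simpa [Gs.mul_zero] using hy⟩).clm_comp continuousOn_const

theorem hasDerivAt_neg_gdil_mul_gdil (z : Fin n → ℝ) {t : ℝ} (ht : t ≠ 0) :
    HasDerivAt (fun s => Gs.mul (-(gdil Gs.w t z)) (gdil Gs.w s z))
      (fun k => t ^ (Gs.w k - 1) * deriv (fun u => Gs.mul (-z) (gdil Gs.w u z)) 1 k) t := by
  have hsm : ContDiff ℝ (⊤ : ℕ∞) fun u : ℝ => Gs.mul (-z) (gdil Gs.w u z) :=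
    Gs.smooth.comp (contDiff_const.prodMk
      ((contDiff_gdil Gs.w).comp (contDiff_id.prodMk contDiff_const)))
  have h1 : HasDerivAt (fun u : ℝ => Gs.mul (-z) (gdil Gs.w u z))
      (deriv (fun u => Gs.mul (-z) (gdil Gs.w u z)) 1) (t⁻¹ * t) := by
    rw [inv_mul_cancel₀ ht]
    exact (hsm.differentiable (by simp) 1).hasDerivAt
  refine hasDerivAt_pi.2 fun k => ?_
  have h2 := (hasDerivAt_pi.1 (h1.scomp t ((hasDerivAt_id t).const_mul t⁻¹)) k).const_mul
    (t ^ Gs.w k)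
  have heq : ∀ s, Gs.mul (-(gdil Gs.w t z)) (gdil Gs.w s z) k =
      t ^ Gs.w k * Gs.mul (-z) (gdil Gs.w (t⁻¹ * s) z) k := by
    intro s
    have h3 := congrFun (Gs.dil_mul t (-z) (gdil Gs.w (t⁻¹ * s) z)) k
    rw [gdil_gdil, mul_inv_cancel_left₀ ht, gdil_neg] at h3
    exact h3.symm
  simp only [heq]
  refine h2.congr_deriv ?_
  simp only [Pi.smul_apply, smul_eq_mul, mul_one]
  rw [← mul_assoc, ← pow_sub_one_mul (Gs.w_pos k).ne' t, mul_inv_cancel_right₀ ht]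

theorem increment_gdil_isBigO (hU : IsOpen U) (hΦ : ContDiffOn ℝ (⊤ : ℕ∞) Φ U)
    (hfil : ∀ y ∈ U, ∀ k i, Gs.w k < Hs.w i → leftDiff Gs Hs Φ y (Pi.single k 1) i = 0)
    {x : Fin n → ℝ} (hx : x ∈ U) (z : Fin n → ℝ) (i : Fin m) :
    (fun t => increment Gs Hs Φ (x, gdil Gs.w t z) i) =O[𝓝[>] 0] fun t : ℝ => t ^ Hs.w i := by
  set g : ℝ → Fin m → ℝ := fun t => increment Gs Hs Φ (x, gdil Gs.w t z) with hg
  set γ : ℝ → Fin n → ℝ := fun t => Gs.mul x (gdil Gs.w t z) with hγ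
  set η : ℝ → Fin n → ℝ := fun t k =>
    t ^ (Gs.w k - 1) * deriv (fun u => Gs.mul (-z) (gdil Gs.w u z)) 1 k with hη
  have hdil : Continuous fun t : ℝ => gdil Gs.w t z :=
    (contDiff_gdil Gs.w).continuous.comp (by fun_prop : Continuous fun t : ℝ => (t, z))
  have hγc : Continuous γ :=
    Gs.smooth.continuous.comp (continuous_const.prodMk hdil)
  have hγ0 : γ 0 = x := by simp [hγ, Gs.gdil_zero_left, Gs.mul_zero]
  have hγU : ∀ᶠ t in 𝓝 (0 : ℝ), γ t ∈ U :=
    hγc.continuousAt.eventually (by rw [hγ0]; exact hU.mem_nhds hx)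
  have hderiv : ∀ t, 0 < t → γ t ∈ U → HasDerivAt g
      (∑ l, leftDiff Gs Hs Φ (γ t) (η t) l • Hs.leftField l (g t)) t := by
    intro t ht htU
    have h1 := hasDerivAt_increment_curve Gs Hs hU hΦ htU
      (hasDerivAt_neg_gdil_mul_gdil Gs z ht.ne') (Gs.neg_mul _)
    have h2 := Hs.hasDerivAt_mul_curve (g t) h1 (by rw [Gs.neg_mul, increment_zero])
    refine h2.congr_of_eventuallyEq (Eventually.of_forall fun s => ?_)
    simp only [hγ, hg]
    rw [← neg_increment_mul_increment, Hs.mul_neg_cancel_left]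
  have hβ : ∀ l, (fun t => leftDiff Gs Hs Φ (γ t) (η t) l) =O[𝓝[>] 0]
      fun t : ℝ => t ^ (Hs.w l - 1) := by
    intro l
    have hexp : (fun t => leftDiff Gs Hs Φ (γ t) (η t) l) =
        fun t => ∑ k, η t k * leftDiff Gs Hs Φ (γ t) (Pi.single k 1) l := by
      funext t
      conv_lhs => rw [pi_eq_sum_univ' (η t), map_sum]
      simp only [Finset.sum_apply, map_smul, Pi.smul_apply, smul_eq_mul]
    rw [hexp]
    refine Asymptotics.IsBigO.fun_sum fun k _ => ?_
    rcases lt_or_ge (Gs.w k) (Hs.w l) with h | h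
    · refine (Asymptotics.isBigO_zero _ _).congr' ?_ EventuallyEq.rfl
      filter_upwards [mem_nhdsWithin_of_mem_nhds hγU] with t ht
      rw [hfil _ ht k l h, mul_zero]
    · have hb : (fun t => leftDiff Gs Hs Φ (γ t) (Pi.single k 1) l) =O[𝓝[>] 0]
          fun _ => (1 : ℝ) := by
        have hca : ContinuousAt (fun t => leftDiff Gs Hs Φ (γ t) (Pi.single k 1) l) 0 := by
          have h1 : ContinuousAt (leftDiff Gs Hs Φ) (γ 0) :=
            (continuousOn_leftDiff Gs Hs hU hΦ).continuousAt (by rw [hγ0]; exact hU.mem_nhds hx)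
          have h2 : ContinuousAt (fun t => leftDiff Gs Hs Φ (γ t)) 0 :=
            ContinuousAt.comp (f := γ) h1 hγc.continuousAt
          exact continuousAt_pi.1 (h2.clm_apply continuousAt_const) l
        exact (hca.tendsto.isBigO_one ℝ).mono nhdsWithin_le_nhds
      have ha : (fun t => η t k) =O[𝓝[>] 0] fun t : ℝ => t ^ (Hs.w l - 1) := by
        refine Asymptotics.IsBigO.of_bound
          ‖deriv (fun u => Gs.mul (-z) (gdil Gs.w u z)) 1 k‖ ?_
        filter_upwards [self_mem_nhdsWithin,
          mem_nhdsWithin_of_mem_nhds (Iio_mem_nhds one_pos)] with t ht ht1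
        have ht : 0 < t := ht
        have ht1 : t < 1 := ht1
        simp only [hη, norm_mul]
        rw [mul_comm]
        refine mul_le_mul_of_nonneg_left ?_ (norm_nonneg _)
        rw [Real.norm_of_nonneg (by positivity), Real.norm_of_nonneg (by positivity)]
        exact pow_le_pow_of_le_one ht.le ht1.le (by omega)
      simpa using ha.mul hb
  have key : ∀ N, ∀ i, Hs.w i = N → (fun t => g t i) =O[𝓝[>] 0] fun t : ℝ => t ^ Hs.w i := by
    intro N
    induction N using Nat.strong_induction_on with
    | _ N ih =>
      rintro i rfl
      have hd' : (fun t => ∑ l, leftDiff Gs Hs Φ (γ t) (η t) l * Hs.leftField l (g t) i)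
          =O[𝓝[>] 0] fun t : ℝ => t ^ (Hs.w i - 1) := by
        refine Asymptotics.IsBigO.fun_sum fun l _ => ?_
        rcases lt_or_ge (Hs.w i) (Hs.w l) with h | h
        · simp only [Hs.leftField_eq_zero h, mul_zero]
          exact Asymptotics.isBigO_zero _ _
        · have h1 := (hβ l).mul (Hs.leftField_isBigO h fun k hk => ih _ hk k rfl)
          have hw := Hs.w_pos l
          simpa only [← pow_add, show Hs.w l - 1 + (Hs.w i - Hs.w l) = Hs.w i - 1 by omega] using h1
      obtain ⟨C, hC⟩ := hd'.bound
      obtain ⟨r, hr, hrC⟩ := (mem_nhdsGT_iff_exists_Ioo_subset (a := (0 : ℝ))).1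
        (hC.and (mem_nhdsWithin_of_mem_nhds hγU))
      have hr : 0 < r := hr
      have hmem : ∀ t ∈ Ioo 0 r, γ t ∈ U := fun t ht => (hrC ht).2
      have hcont : ContinuousOn (fun t => g t i) (Ico 0 r) := by
        have h1 : ContinuousOn g (Ico 0 r) := by
          refine (contDiffOn_increment Gs Hs hΦ).continuousOn.comp
            (by fun_prop : ContinuousOn (fun t => (x, gdil Gs.w t z)) _) fun t ht => ⟨hx, ?_⟩
          rcases ht.1.eq_or_lt with rfl | h0
          · exact (show γ 0 ∈ U by rw [hγ0]; exact hx)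
          · exact hmem t ⟨h0, ht.2⟩
        exact (continuous_apply i).comp_continuousOn h1
      have hmv := abs_le_mul_pow_of_deriv_le (C := C) (k := Hs.w i - 1) hcont
        (fun t ht => by
          simpa [Finset.sum_apply] using hasDerivAt_pi.1 (hderiv t ht.1 (hmem t ht)) i)
        (fun t ht => by
          have h1 := (hrC ht).1
          rwa [Real.norm_of_nonneg (pow_nonneg ht.1.le _)] at h1)
        (by simp [hg, Gs.gdil_zero_left, increment_zero])
      rw [Nat.sub_add_cancel (Hs.w_pos i)] at hmv
      refine Asymptotics.IsBigO.of_bound C ?_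
      filter_upwards [Ioo_mem_nhdsGT hr] with t ht
      rw [Real.norm_of_nonneg (pow_nonneg ht.1.le _)]
      exact hmv t ⟨ht.1.le, ht.2⟩
  exact key _ i rfl

theorem exists_tendstoUniformlyOn_pq_apply (hU : IsOpen U) (hΦ : ContDiffOn ℝ (⊤ : ℕ∞) Φ U)
    (hfil : ∀ y ∈ U, ∀ k i, Gs.w k < Hs.w i → leftDiff Gs Hs Φ y (Pi.single k 1) i = 0)
    {p₀ : (Fin n → ℝ) × (Fin n → ℝ)} (hp₀ : p₀.1 ∈ U) (i : Fin m) :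
    ∃ (a : (Fin n → ℝ) × (Fin n → ℝ) → ℝ) (S : Set ((Fin n → ℝ) × (Fin n → ℝ))), S ∈ 𝓝 p₀ ∧
      ContDiffOn ℝ (⊤ : ℕ∞) a S ∧
      TendstoUniformlyOn (fun (ε : ℝ) p => pq Gs Hs Φ ε p.1 p.2 i) a (𝓝[>] 0) S := by
  set Ω : Set (ℝ × (Fin n → ℝ) × (Fin n → ℝ)) :=
    {q | q.2.1 ∈ U ∧ Gs.mul q.2.1 (gdil Gs.w q.1 q.2.2) ∈ U} with hΩ
  set ψ : ℝ × (Fin n → ℝ) × (Fin n → ℝ) → (Fin n → ℝ) × (Fin n → ℝ) :=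
    fun q => (q.2.1, gdil Gs.w q.1 q.2.2) with hψ
  have hψs : ContDiff ℝ (⊤ : ℕ∞) ψ :=
    (contDiff_fst.comp contDiff_snd).prodMk ((contDiff_gdil Gs.w).comp
      (contDiff_fst.prodMk (contDiff_snd.comp contDiff_snd)))
  have hΩo : IsOpen Ω := (isOpen_increment_domain Gs hU).preimage hψs.continuous
  have hf : ContDiffOn ℝ (⊤ : ℕ∞) (fun q => increment Gs Hs Φ (ψ q) i) Ω :=
    (contDiff_apply ℝ ℝ i).comp_contDiffOn
      ((contDiffOn_increment Gs Hs hΦ).comp hψs.contDiffOn fun q hq => hq)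
  have h0 : ((0 : ℝ), p₀) ∈ Ω := by
    simp [hΩ, Gs.gdil_zero_left, Gs.mul_zero, hp₀]
  obtain ⟨a, ρ, C, hρ, ha, hbd⟩ := exists_taylor_expansion_fst hΩo h0 (Hs.w i + 1) hf
  set S := Metric.ball p₀ ρ ∩ {p | p.1 ∈ U} with hS
  have hSn : S ∈ 𝓝 p₀ := inter_mem (Metric.ball_mem_nhds _ hρ)
    ((hU.preimage continuous_fst).mem_nhds hp₀)
  have hzero : ∀ p ∈ S, ∀ j < Hs.w i, a j p = 0 := by
    intro p hp
    have hO := increment_gdil_isBigO Gs Hs hU hΦ hfil hp.2 p.2 i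
    refine coeff_eq_zero_of_isBigO (a := fun j => a j p) ?_ hO
    have h1 : (fun t => increment Gs Hs Φ (p.1, gdil Gs.w t p.2) i -
        ∑ j ∈ Finset.range (Hs.w i + 1), a j p * t ^ j) =O[𝓝[>] 0]
        fun t : ℝ => t ^ Hs.w i := by
      refine Asymptotics.IsBigO.of_bound |C| ?_
      filter_upwards [Ioo_mem_nhdsGT (lt_min hρ one_pos)] with t ht
      have ht1 := lt_min_iff.1 ht.2
      refine (hbd t ⟨ht.1.le, ht1.1⟩ p hp.1).trans ?_
      rw [Real.norm_of_nonneg (pow_nonneg ht.1.le _)]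
      refine (mul_le_mul_of_nonneg_right (le_abs_self C) (pow_nonneg ht.1.le _)).trans ?_
      exact mul_le_mul_of_nonneg_left (pow_le_pow_of_le_one ht.1.le ht1.2.le (Nat.le_succ _))
        (abs_nonneg _)
    have h2 : (fun t : ℝ => a (Hs.w i) p * t ^ Hs.w i) =O[𝓝[>] 0] fun t : ℝ => t ^ Hs.w i :=
      Asymptotics.isBigO_const_mul_self _ _ _
    refine (h1.add h2).congr_left fun t => ?_
    rw [Finset.sum_range_succ]
    ring
  refine ⟨a (Hs.w i), S, hSn, (ha _).mono inter_subset_left, ?_⟩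
  rw [Metric.tendstoUniformlyOn_iff]
  intro δ hδ
  have hlim : ∀ᶠ t : ℝ in 𝓝[>] 0, C * t < δ := by
    have h1 : Continuous fun t : ℝ => C * t := by fun_prop
    have h2 := (h1.tendsto 0).mono_left (nhdsWithin_le_nhds (s := Ioi 0))
    exact h2.eventually_lt_const (by simpa using hδ)
  filter_upwards [hlim, Ioo_mem_nhdsGT hρ] with t htδ ht p hp
  have h1 := hbd t ⟨ht.1.le, ht.2⟩ p hp.1
  rw [Finset.sum_range_succ, Finset.sum_eq_zero fun j hj => by
    rw [hzero p hp j (Finset.mem_range.1 hj), zero_mul], zero_add] at h1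
  have hpow : 0 < t ^ Hs.w i := pow_pos ht.1 _
  have h2 : pq Gs Hs Φ t p.1 p.2 i = (t ^ Hs.w i)⁻¹ * increment Gs Hs Φ (ψ (t, p)) i := by
    simp [pq, gdil, increment, hψ]
  rw [dist_comm, Real.dist_eq, h2]
  refine lt_of_le_of_lt ?_ htδ
  refine le_of_mul_le_mul_left ?_ hpow
  calc t ^ Hs.w i * |(t ^ Hs.w i)⁻¹ * increment Gs Hs Φ (ψ (t, p)) i - a (Hs.w i) p|
      = |increment Gs Hs Φ (ψ (t, p)) i - a (Hs.w i) p * t ^ Hs.w i| := by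
        conv_lhs => rw [← abs_of_pos hpow, ← abs_mul, abs_of_pos hpow]
        congr 1
        field_simp
    _ ≤ t ^ Hs.w i * (C * t) := h1.trans_eq (by ring)

theorem exists_tendstoUniformlyOn_pq (hU : IsOpen U) (hΦ : ContDiffOn ℝ (⊤ : ℕ∞) Φ U)
    (hfil : ∀ y ∈ U, ∀ k i, Gs.w k < Hs.w i → leftDiff Gs Hs Φ y (Pi.single k 1) i = 0)
    {p₀ : (Fin n → ℝ) × (Fin n → ℝ)} (hp₀ : p₀.1 ∈ U) :
    ∃ (a : (Fin n → ℝ) × (Fin n → ℝ) → Fin m → ℝ) (S : Set ((Fin n → ℝ) × (Fin n → ℝ))),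
      S ∈ 𝓝 p₀ ∧ ContDiffOn ℝ (⊤ : ℕ∞) a S ∧
      TendstoUniformlyOn (fun (ε : ℝ) p => pq Gs Hs Φ ε p.1 p.2) a (𝓝[>] 0) S := by
  choose a S hS ha hlim using exists_tendstoUniformlyOn_pq_apply Gs Hs hU hΦ hfil hp₀
  refine ⟨fun p i => a i p, ⋂ i, S i, iInter_mem.2 hS,
    contDiffOn_pi.2 fun i => (ha i).mono (iInter_subset _ i), ?_⟩
  rw [Metric.tendstoUniformlyOn_iff]
  intro δ hδ
  have h1 : ∀ᶠ ε : ℝ in 𝓝[>] 0, ∀ i, ∀ p ∈ S i, dist (a i p) (pq Gs Hs Φ ε p.1 p.2 i) < δ :=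
    eventually_all.2 fun i => Metric.tendstoUniformlyOn_iff.1 (hlim i) δ hδ
  filter_upwards [h1] with ε hε p hp
  exact (dist_pi_lt_iff hδ).2 fun i => hε i p (mem_iInter.1 hp i)

theorem leftDiff_apply_eq_zero_of_tendsto_pq (hU : IsOpen U) (hΦ : ContDiffOn ℝ (⊤ : ℕ∞) Φ U)
    {x : Fin n → ℝ} (hx : x ∈ U) {j : ℕ} {V : Fin n → ℝ} (hj : 1 ≤ j) (hV : inLayer Gs.w j V)
    {L : Fin m → ℝ} (hL : Tendsto (fun ε : ℝ => pq Gs Hs Φ ε x V) (𝓝[>] 0) (𝓝 L))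
    {i : Fin m} (hi : j < Hs.w i) : leftDiff Gs Hs Φ x V i = 0 := by
  have hdil : ∀ ε : ℝ, gdil Gs.w ε V = ε ^ j • V := by
    intro ε
    ext k
    by_cases hk : Gs.w k = j
    · simp [gdil, hk]
    · simp [gdil, hV k hk]
  have hs : HasDerivAt (fun t : ℝ => t • V) V 0 := by
    simpa using (hasDerivAt_id (0 : ℝ)).smul_const V
  have h1 := hasDerivAt_pi.1 (hasDerivAt_increment_curve Gs Hs hU hΦ hx hs (zero_smul _ _)) i
  have h2 := h1.tendsto_slope_zero_right
  have hpow : Tendsto (fun ε : ℝ => ε ^ j) (𝓝[>] 0) (𝓝[>] 0) := by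
    refine tendsto_nhdsWithin_iff.2 ⟨?_, ?_⟩
    · have := (continuous_pow (M := ℝ) j).tendsto 0
      rw [zero_pow (by omega)] at this
      exact this.mono_left nhdsWithin_le_nhds
    · filter_upwards [self_mem_nhdsWithin] with ε hε
      exact pow_pos (show (0 : ℝ) < ε from hε) j
  have h3 := h2.comp hpow
  have h4 : Tendsto (fun ε : ℝ => ε ^ (Hs.w i - j) * pq Gs Hs Φ ε x V i) (𝓝[>] 0)
      (𝓝 (0 * L i)) := by
    refine Tendsto.mul ?_ ((continuous_apply i).continuousAt.tendsto.comp hL)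
    have := (continuous_pow (M := ℝ) (Hs.w i - j)).tendsto 0
    rw [zero_pow (by omega)] at this
    exact this.mono_left nhdsWithin_le_nhds
  rw [zero_mul] at h4
  refine tendsto_nhds_unique h3 (h4.congr' ?_)
  filter_upwards [self_mem_nhdsWithin] with ε hε
  have hε : 0 < ε := hε
  have hw : ε ^ Hs.w i = ε ^ j * ε ^ (Hs.w i - j) := (pow_mul_pow_sub ε hi.le).symm
  simp only [pq, gdil, Function.comp_apply, zero_add, zero_smul, increment_zero, inv_pow,
    Pi.zero_apply, sub_zero, smul_eq_mul]
  rw [← hdil ε, hw]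
  simp only [increment]
  have e1 := (pow_pos hε j).ne'
  have e2 := (pow_pos hε (Hs.w i - j)).ne'
  rw [mul_inv, ← mul_assoc, mul_left_comm, mul_inv_cancel₀ e2, mul_one]

end Increment

/-- a smooth map `Φ` from an open set `U` of a graded Lie group `G`
to a graded Lie group `H` (in exponential coordinates) is uniformly Pansu
differentiable on `U` (there is a Pansu derivative `PD` for which the defining
limits hold pointwise on `U` and locally uniformly on `U × G`) if and only if
`Φ` preserves the filtration at every `x ∈ U` (`𝔡_xΦ(𝔤_j) ⊆ 𝔥₁ ⊕ ⋯ ⊕ 𝔥_j` for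
all `j`). Moreover, in that case `(x, z) ↦ PD_xΦ(z)` is smooth on `U × G`. -/
theorem uniform_pansu_iff_filtration_preserving {n m : ℕ}
    (Gs : GradedGroup n) (Hs : GradedGroup m)
    (U : Set (Fin n → ℝ)) (hU : IsOpen U)
    (Φ : (Fin n → ℝ) → (Fin m → ℝ)) (hΦ : ContDiffOn ℝ (⊤ : ℕ∞) Φ U)
    (DPhi : (Fin n → ℝ) → (Fin n → ℝ) → (Fin m → ℝ))
    (hD : ∀ x ∈ U, ∀ V : Fin n → ℝ,
      HasDerivAt (fun t : ℝ => Hs.mul (-(Φ x)) (Φ (Gs.mul x (t • V)))) (DPhi x V) 0) :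
    ((∃ PD : (Fin n → ℝ) → (Fin n → ℝ) → (Fin m → ℝ),
        PansuPW Gs Hs Φ U PD ∧ PansuLocUnif Gs Hs Φ U PD) ↔
      (∀ x ∈ U, ∀ j : ℕ, 1 ≤ j → ∀ V : Fin n → ℝ, inLayer Gs.w j V →
        ∀ i : Fin m, j < Hs.w i → DPhi x V i = 0)) ∧
    (∀ PD : (Fin n → ℝ) → (Fin n → ℝ) → (Fin m → ℝ),
      PansuPW Gs Hs Φ U PD → PansuLocUnif Gs Hs Φ U PD →
      ContDiffOn ℝ (⊤ : ℕ∞) (fun p : (Fin n → ℝ) × (Fin n → ℝ) => PD p.1 p.2)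
        (U ×ˢ (Set.univ : Set (Fin n → ℝ)))) := by
  have hDeq : ∀ x ∈ U, ∀ V, DPhi x V = leftDiff Gs Hs Φ x V := by
    intro x hx V
    have hs : HasDerivAt (fun t : ℝ => t • V) V 0 := by
      simpa using (hasDerivAt_id (0 : ℝ)).smul_const V
    exact (hD x hx V).unique (hasDerivAt_increment_curve Gs Hs hU hΦ hx hs (zero_smul _ _))
  have hlayer : ∀ k : Fin n, inLayer Gs.w (Gs.w k) (Pi.single k 1) := by
    intro k l hl
    exact Pi.single_eq_of_ne (fun h => hl (by rw [h])) _
  have hfil_of_pansu : ∀ PD, PansuPW Gs Hs Φ U PD →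
      ∀ x ∈ U, ∀ j : ℕ, 1 ≤ j → ∀ V : Fin n → ℝ, inLayer Gs.w j V →
        ∀ i : Fin m, j < Hs.w i → leftDiff Gs Hs Φ x V i = 0 :=
    fun PD hPD x hx j hj V hV i hi =>
      leftDiff_apply_eq_zero_of_tendsto_pq Gs Hs hU hΦ hx hj hV (hPD x hx V) hi
  refine ⟨⟨?_, ?_⟩, ?_⟩
  · rintro ⟨PD, hPD, -⟩ x hx j hj V hV i hi
    rw [hDeq x hx]
    exact hfil_of_pansu PD hPD x hx j hj V hV i hi
  · intro h
    have hfil : ∀ y ∈ U, ∀ k i, Gs.w k < Hs.w i → leftDiff Gs Hs Φ y (Pi.single k 1) i = 0 := by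
      intro y hy k i hki
      rw [← hDeq y hy]
      exact h y hy _ (Gs.w_pos k) _ (hlayer k) i hki
    have hex : ∀ x z, ∃ L, x ∈ U → Tendsto (fun ε => pq Gs Hs Φ ε x z) (𝓝[>] (0 : ℝ)) (𝓝 L) := by
      intro x z
      by_cases hx : x ∈ U
      · obtain ⟨a, S, hS, -, hlim⟩ := exists_tendstoUniformlyOn_pq Gs Hs hU hΦ hfil (p₀ := (x, z)) hx
        exact ⟨a (x, z), fun _ => hlim.tendsto_at (mem_of_mem_nhds hS)⟩
      · exact ⟨0, fun h => absurd h hx⟩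
    choose PD hPD using hex
    refine ⟨PD, fun x hx z => hPD x z hx, fun x hx z => ?_⟩
    obtain ⟨a, S, hS, -, hlim⟩ := exists_tendstoUniformlyOn_pq Gs Hs hU hΦ hfil (p₀ := (x, z)) hx
    obtain ⟨V, hV, Z, hZ, hVZ⟩ := mem_nhds_prod_iff.1 hS
    have hsub : (V ∩ U) ×ˢ Z ⊆ S := (prod_mono inter_subset_left Subset.rfl).trans hVZ
    refine ⟨V, hV, Z, hZ, (hlim.mono hsub).congr_right fun p hp => ?_⟩
    exact tendsto_nhds_unique (hlim.tendsto_at (hsub hp)) (hPD p.1 p.2 hp.1.2)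
  · intro PD hPD _ p hp
    have hfil : ∀ y ∈ U, ∀ k i, Gs.w k < Hs.w i → leftDiff Gs Hs Φ y (Pi.single k 1) i = 0 :=
      fun y hy k i hki => hfil_of_pansu PD hPD y hy _ (Gs.w_pos k) _ (hlayer k) i hki
    obtain ⟨a, S, hS, ha, hlim⟩ := exists_tendstoUniformlyOn_pq Gs Hs hU hΦ hfil hp.1
    refine ((ha.contDiffAt hS).congr_of_eventuallyEq ?_).contDiffWithinAt
    filter_upwards [hS, (hU.preimage continuous_fst).mem_nhds hp.1] with q hqS hqU
    exact tendsto_nhds_unique (hPD q.1 hqU q.2) (hlim.tendsto_at hqS)
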